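/- (Proposition 2, formula (5)) For every integer p ≥ 1, every μ, γ ∈ ℝ^p, every symmetric positive definite p×p real matrix Σ and every y ∈ ℝ^p, writing a = (y−μ)ᵀΣ⁻¹(y−μ) and α = √(1 + γᵀΣ⁻¹γ), the conditional expectation E(V^{-1} | y) = ∫_0^∞ v^{-1} · h(v) dv equals (1 + √((1 + γᵀΣ⁻¹γ) · (y−μ)ᵀΣ⁻¹(y−μ))) / (1 + γᵀΣ⁻¹γ), i.e. (1 + α√a)/α². -/

import Mathlib

open MeasureTheory Real Matrix

open Filter Set Topology

/-- The unnormalised Gaussian distribution function, centred so that it is odd. -/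
noncomputable def gaussPrimitive (x : ℝ) : ℝ := ∫ t in (0:ℝ)..x, exp (-(1 / 2) * t ^ 2)

lemma hasDerivAt_gaussPrimitive (x : ℝ) :
    HasDerivAt gaussPrimitive (exp (-(1 / 2) * x ^ 2)) x :=
  (Continuous.integral_hasStrictDerivAt (f := fun t : ℝ => exp (-(1 / 2) * t ^ 2))
    (by fun_prop) 0 x).hasDerivAt

lemma gaussPrimitive_neg (x : ℝ) : gaussPrimitive (-x) = -gaussPrimitive x := by
  have h := intervalIntegral.integral_comp_neg (a := 0) (b := x)
    (fun t : ℝ => exp (-(1 / 2) * t ^ 2))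
  simp only [even_two.neg_pow, neg_zero] at h
  rw [gaussPrimitive, gaussPrimitive, h, intervalIntegral.integral_symm]

lemma tendsto_gaussPrimitive_atTop :
    Tendsto gaussPrimitive atTop (𝓝 (√(2 * π) / 2)) := by
  have h := intervalIntegral_tendsto_integral_Ioi (0:ℝ)
    (integrable_exp_neg_mul_sq (b := 1 / 2) (by norm_num)).integrableOn tendsto_id
  rwa [integral_gaussian_Ioi, show π / (1 / 2) = 2 * π by ring] at h

lemma tendsto_gaussPrimitive_atBot :
    Tendsto gaussPrimitive atBot (𝓝 (-(√(2 * π) / 2))) := by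
  have h := (tendsto_gaussPrimitive_atTop.comp tendsto_neg_atBot_atTop).neg
  refine h.congr fun x => ?_
  simp [gaussPrimitive_neg]

/-- An antiderivative of `s ↦ s² exp (-(α s - b / s)² / 2)` on `(0, ∞)`. -/
noncomputable def sqMulExpPrimitive (α b s : ℝ) : ℝ :=
  (1 / α ^ 2) * ((1 / (2 * α)) *
      (gaussPrimitive (α * s - b / s) + exp (2 * α * b) * gaussPrimitive (α * s + b / s)) +
    (b / 2) *
      (gaussPrimitive (α * s - b / s) - exp (2 * α * b) * gaussPrimitive (α * s + b / s)) -
    s * exp (-(1 / 2) * (α * s - b / s) ^ 2))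

lemma hasDerivAt_sqMulExpPrimitive {α : ℝ} (hα : 0 < α) (b : ℝ) {s : ℝ} (hs : 0 < s) :
    HasDerivAt (sqMulExpPrimitive α b) (s ^ 2 * exp (-(1 / 2) * (α * s - b / s) ^ 2)) s := by
  have hd : HasDerivAt (fun s : ℝ => b / s) (-b / s ^ 2) s := by
    simpa [div_eq_mul_inv] using (hasDerivAt_inv hs.ne').const_mul b
  have hl : HasDerivAt (fun s : ℝ => α * s) α s := by
    simpa using (hasDerivAt_id s).const_mul α
  have hm := hl.sub hd
  have hp := hl.add hd
  have h1 := (hasDerivAt_gaussPrimitive (α * s - b / s)).comp s hm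
  have h2 := ((hasDerivAt_gaussPrimitive (α * s + b / s)).comp s hp).const_mul (exp (2 * α * b))
  have h3 := (hasDerivAt_id s).mul (((hm.pow 2).const_mul (-(1 / 2))).exp)
  have h := ((((h1.add h2).const_mul (1 / (2 * α))).add
    ((h1.sub h2).const_mul (b / 2))).sub h3).const_mul (1 / α ^ 2)
  refine h.congr_deriv ?_
  have hE : exp (2 * α * b) * exp (-(1 / 2) * (α * s + b / s) ^ 2) =
      exp (-(1 / 2) * (α * s - b / s) ^ 2) := by
    rw [← exp_add]
    congr 1
    field_simp
    ring
  simp only [← mul_assoc, hE]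
  simp
  field_simp
  ring

lemma tendsto_mul_exp_neg_half_sq :
    Tendsto (fun x : ℝ => x * exp (-(1 / 2) * x ^ 2)) atTop (𝓝 0) := by
  have h := (rpow_mul_exp_neg_mul_sq_isLittleO_exp_neg (b := 1 / 2) (by norm_num) 1)
  simp only [rpow_one] at h
  refine h.trans_tendsto ?_
  refine tendsto_exp_atBot.comp ?_
  exact tendsto_id.const_mul_atTop_of_neg (by norm_num)

lemma tendsto_exp_neg_half_sq :
    Tendsto (fun x : ℝ => exp (-(1 / 2) * x ^ 2)) atTop (𝓝 0) :=
  tendsto_exp_atBot.comp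
    ((tendsto_pow_atTop two_ne_zero).const_mul_atTop_of_neg (by norm_num))

lemma tendsto_sqMulExpPrimitive_atTop {α : ℝ} (hα : 0 < α) (b : ℝ) :
    Tendsto (sqMulExpPrimitive α b) atTop (𝓝 ((1 / α ^ 2) * ((1 / (2 * α)) *
      (√(2 * π) / 2 + exp (2 * α * b) * (√(2 * π) / 2)) +
      (b / 2) * (√(2 * π) / 2 - exp (2 * α * b) * (√(2 * π) / 2)) - 0))) := by
  have hl : Tendsto (fun s : ℝ => α * s) atTop atTop := tendsto_id.const_mul_atTop hα
  have hd : Tendsto (fun s : ℝ => b / s) atTop (𝓝 0) := tendsto_const_nhds.div_atTop tendsto_id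
  have hm : Tendsto (fun s : ℝ => α * s - b / s) atTop atTop := by
    simpa only [sub_eq_add_neg] using hl.atTop_add hd.neg
  have hp : Tendsto (fun s : ℝ => α * s + b / s) atTop atTop := hl.atTop_add hd
  have h1 := tendsto_gaussPrimitive_atTop.comp hm
  have h2 := (tendsto_gaussPrimitive_atTop.comp hp).const_mul (exp (2 * α * b))
  have h3 : Tendsto (fun s : ℝ => s * exp (-(1 / 2) * (α * s - b / s) ^ 2)) atTop (𝓝 0) := by
    have h := ((tendsto_mul_exp_neg_half_sq.comp hm).add
      (hd.mul (tendsto_exp_neg_half_sq.comp hm))).const_mul α⁻¹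
    simp only [mul_zero, add_zero] at h
    refine h.congr fun s => ?_
    simp only [Function.comp_apply]
    generalize b / s = d
    field_simp
    ring
  exact ((((h1.add h2).const_mul (1 / (2 * α))).add
    ((h1.sub h2).const_mul (b / 2))).sub h3).const_mul (1 / α ^ 2)

lemma tendsto_mul_exp_neg_nhdsGT_zero (α b : ℝ) :
    Tendsto (fun s : ℝ => s * exp (-(1 / 2) * (α * s - b / s) ^ 2)) (𝓝[>] 0) (𝓝 0) := by
  refine squeeze_zero' (g := id) ?_ ?_ (tendsto_id.mono_left nhdsWithin_le_nhds)
  · filter_upwards [self_mem_nhdsWithin] with s hs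
    have hs : 0 < s := hs
    positivity
  · filter_upwards [self_mem_nhdsWithin] with s hs
    have hs : 0 < s := hs
    refine mul_le_of_le_one_right hs.le (exp_le_one_iff.mpr ?_)
    nlinarith [sq_nonneg (α * s - b / s)]

lemma tendsto_sqMulExpPrimitive_nhdsGT_zero (α : ℝ) {b : ℝ} (hb : 0 < b) :
    Tendsto (sqMulExpPrimitive α b) (𝓝[>] 0) (𝓝 ((1 / α ^ 2) * ((1 / (2 * α)) *
      (-(√(2 * π) / 2) + exp (2 * α * b) * (√(2 * π) / 2)) +
      (b / 2) * (-(√(2 * π) / 2) - exp (2 * α * b) * (√(2 * π) / 2)) - 0))) := by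
  have hl : Tendsto (fun s : ℝ => α * s) (𝓝[>] 0) (𝓝 0) := by
    have : Continuous fun s : ℝ => α * s := by fun_prop
    simpa using (this.tendsto 0).mono_left nhdsWithin_le_nhds
  have hd : Tendsto (fun s : ℝ => b / s) (𝓝[>] 0) atTop := by
    simpa only [div_eq_mul_inv] using tendsto_inv_nhdsGT_zero.const_mul_atTop hb
  have hm : Tendsto (fun s : ℝ => α * s - b / s) (𝓝[>] 0) atBot := by
    simpa only [sub_eq_add_neg, Function.comp_def] using
      hl.add_atBot (tendsto_neg_atTop_atBot.comp hd)
  have hp : Tendsto (fun s : ℝ => α * s + b / s) (𝓝[>] 0) atTop := hl.add_atTop hd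
  have h1 := tendsto_gaussPrimitive_atBot.comp hm
  have h2 := (tendsto_gaussPrimitive_atTop.comp hp).const_mul (exp (2 * α * b))
  exact ((((h1.add h2).const_mul (1 / (2 * α))).add
    ((h1.sub h2).const_mul (b / 2))).sub (tendsto_mul_exp_neg_nhdsGT_zero α b)).const_mul
      (1 / α ^ 2)

lemma tendsto_sqMulExpPrimitive_zero_nhdsGT_zero (α : ℝ) :
    Tendsto (sqMulExpPrimitive α 0) (𝓝[>] 0) (𝓝 0) := by
  have hc : Continuous (sqMulExpPrimitive α 0) := by
    have hg : Continuous gaussPrimitive :=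
      continuous_iff_continuousAt.mpr fun x => (hasDerivAt_gaussPrimitive x).continuousAt
    unfold sqMulExpPrimitive
    simp only [zero_div, sub_zero, add_zero]
    fun_prop
  have h0 : sqMulExpPrimitive α 0 0 = 0 := by simp [sqMulExpPrimitive, gaussPrimitive]
  simpa [h0] using (hc.tendsto 0).mono_left (nhdsWithin_le_nhds (s := Ioi 0))

lemma integrableOn_sq_mul_exp {α b : ℝ} (hα : 0 < α) :
    IntegrableOn (fun s : ℝ => s ^ 2 * exp (-(1 / 2) * (α * s - b / s) ^ 2)) (Ioi 0) := by
  have hdom := (integrable_rpow_mul_exp_neg_mul_sq (b := α ^ 2 / 2) (by positivity)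
    (s := 2) (by norm_num)).const_mul (exp (α * b))
  refine hdom.integrableOn.mono' ?_ ?_
  · exact Measurable.aestronglyMeasurable (by fun_prop)
  · filter_upwards [ae_restrict_mem measurableSet_Ioi] with s hs
    have hs : 0 < s := hs
    rw [norm_of_nonneg (by positivity), rpow_two, mul_left_comm, ← exp_add]
    refine mul_le_mul_of_nonneg_left (exp_le_exp.mpr ?_) (sq_nonneg s)
    have h : (α * s - b / s) ^ 2 = α ^ 2 * s ^ 2 - 2 * α * b + (b / s) ^ 2 := by
      field_simp
      ring
    nlinarith [sq_nonneg (b / s)]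

lemma integral_Ioi_eq_sub_of_hasDerivAt_of_tendsto {f f' : ℝ → ℝ} {a l m : ℝ}
    (hderiv : ∀ x ∈ Ioi a, HasDerivAt f (f' x) x) (hint : IntegrableOn f' (Ioi a))
    (hl : Tendsto f (𝓝[>] a) (𝓝 l)) (hm : Tendsto f atTop (𝓝 m)) :
    ∫ x in Ioi a, f' x = m - l := by
  have heq : ∀ x ∈ Ioi a, Function.update f a l x = f x := fun x hx =>
    Function.update_of_ne (ne_of_gt hx) _ _
  have h := integral_Ioi_of_hasDerivAt_of_tendsto (f := Function.update f a l) (f' := f')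
    (a := a) (m := m) ?_ (fun x hx => ?_) hint ?_
  · simpa using h
  · rw [continuousWithinAt_update_same, Ici_sdiff_left]
    exact hl
  · refine (hderiv x hx).congr_of_eventuallyEq ?_
    filter_upwards [Ioi_mem_nhds hx] with z hz using heq z hz
  · refine hm.congr' ?_
    filter_upwards [Ioi_mem_atTop a] with z hz using (heq z hz).symm

lemma integral_sq_mul_exp {α b : ℝ} (hα : 0 < α) (hb : 0 ≤ b) :
    ∫ s in Ioi (0:ℝ), s ^ 2 * exp (-(1 / 2) * (α * s - b / s) ^ 2) =
      √(2 * π) / 2 * (1 + α * b) / α ^ 3 := by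
  have hderiv : ∀ s ∈ Ioi (0:ℝ), HasDerivAt (sqMulExpPrimitive α b)
      (s ^ 2 * exp (-(1 / 2) * (α * s - b / s) ^ 2)) s :=
    fun s hs => hasDerivAt_sqMulExpPrimitive hα b hs
  rcases hb.eq_or_lt with rfl | hb
  · rw [integral_Ioi_eq_sub_of_hasDerivAt_of_tendsto hderiv (integrableOn_sq_mul_exp hα)
      (tendsto_sqMulExpPrimitive_zero_nhdsGT_zero α) (tendsto_sqMulExpPrimitive_atTop hα 0)]
    simp only [mul_zero, exp_zero]
    field_simp
    ring
  · rw [integral_Ioi_eq_sub_of_hasDerivAt_of_tendsto hderiv (integrableOn_sq_mul_exp hα)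
      (tendsto_sqMulExpPrimitive_nhdsGT_zero α hb) (tendsto_sqMulExpPrimitive_atTop hα b)]
    field_simp
    ring

lemma integral_inv_mul_inverseGaussian {α b : ℝ} (hα : 0 < α) (hb : 0 ≤ b) :
    ∫ v in Ioi (0:ℝ), v⁻¹ * ((α / √(2 * π)) * exp (α * b) * v ^ (-(3:ℝ) / 2) *
        exp (-(1 / 2) * (b ^ 2 * v + α ^ 2 * v⁻¹))) = (1 + α * b) / α ^ 2 := by
  rw [← integral_comp_rpow_Ioi _ (p := -2) (by norm_num)]
  have hpt : ∀ s ∈ Ioi (0:ℝ), (|(-2:ℝ)| * s ^ ((-2:ℝ) - 1)) • ((s ^ (-2:ℝ))⁻¹ *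
      ((α / √(2 * π)) * exp (α * b) * (s ^ (-2:ℝ)) ^ (-(3:ℝ) / 2) *
        exp (-(1 / 2) * (b ^ 2 * s ^ (-2:ℝ) + α ^ 2 * (s ^ (-2:ℝ))⁻¹)))) =
      (2 * α / √(2 * π)) * (s ^ 2 * exp (-(1 / 2) * (α * s - b / s) ^ 2)) := by
    intro s hs
    have hs : 0 < s := hs
    have h2 : s ^ (-2:ℝ) = (s ^ 2)⁻¹ := by rw [rpow_neg hs.le, rpow_two]
    have h3 : s ^ ((-2:ℝ) - 1) = (s ^ 3)⁻¹ := by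
      rw [show (-2:ℝ) - 1 = -(3:ℕ) by norm_num, rpow_neg hs.le, rpow_natCast]
    have h4 : (s ^ (-2:ℝ)) ^ (-(3:ℝ) / 2) = s ^ 3 := by
      rw [← rpow_mul hs.le, show (-2:ℝ) * (-(3:ℝ) / 2) = (3:ℕ) by norm_num, rpow_natCast]
    have hE : exp (-(1 / 2) * (α * s - b / s) ^ 2) =
        exp (α * b) * exp (-(1 / 2) * (b ^ 2 * (s ^ 2)⁻¹ + α ^ 2 * s ^ 2)) := by
      rw [← exp_add]
      congr 1
      field_simp
      ring
    rw [h4, h3, h2, hE, inv_inv, smul_eq_mul, abs_neg, abs_two]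
    field_simp
  rw [setIntegral_congr_fun measurableSet_Ioi hpt, integral_const_mul, integral_sq_mul_exp hα hb]
  have : 0 < √(2 * π) := by positivity
  field_simp

/-- Proposition 2, formula (5): the conditional expectation `E(V⁻¹ | y)` equals
`(1 + √((1 + γᵀΣ⁻¹γ)(y−μ)ᵀΣ⁻¹(y−μ))) / (1 + γᵀΣ⁻¹γ)`. -/
theorem msl_conditional_expectation_Vinv
    (p : ℕ) (hp : 1 ≤ p) (μ γ : Fin p → ℝ)
    (S : Matrix (Fin p) (Fin p) ℝ) (hS : S.PosDef) (y : Fin p → ℝ) :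
    ∫ v in Set.Ioi (0:ℝ),
      v⁻¹ * ((Real.sqrt (1 + γ ⬝ᵥ S⁻¹ *ᵥ γ) / Real.sqrt (2 * π)) *
        Real.exp (Real.sqrt (1 + γ ⬝ᵥ S⁻¹ *ᵥ γ) *
          Real.sqrt ((y - μ) ⬝ᵥ S⁻¹ *ᵥ (y - μ))) *
        v ^ (-(3:ℝ)/2) *
        Real.exp (-(1/2) * (((y - μ) ⬝ᵥ S⁻¹ *ᵥ (y - μ)) * v +
          (Real.sqrt (1 + γ ⬝ᵥ S⁻¹ *ᵥ γ)) ^ 2 * v⁻¹)))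
    = (1 + Real.sqrt ((1 + γ ⬝ᵥ S⁻¹ *ᵥ γ) * ((y - μ) ⬝ᵥ S⁻¹ *ᵥ (y - μ)))) /
      (1 + γ ⬝ᵥ S⁻¹ *ᵥ γ) := by
  have hnn : ∀ x : Fin p → ℝ, 0 ≤ x ⬝ᵥ S⁻¹ *ᵥ x := fun x => by
    simpa using hS.inv.posSemidef.dotProduct_mulVec_nonneg x
  have hq : 0 < 1 + γ ⬝ᵥ S⁻¹ *ᵥ γ := by linarith [hnn γ]
  have h := integral_inv_mul_inverseGaussian (sqrt_pos.mpr hq)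
    (sqrt_nonneg ((y - μ) ⬝ᵥ S⁻¹ *ᵥ (y - μ)))
  rw [sq_sqrt (hnn (y - μ))] at h
  rw [h, sq_sqrt hq.le, sqrt_mul hq.le]
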